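/- Lemma 8.6 ('generalized-DCT'). Let M be a Polish space, let x ↦ μ_x be a continuous map from M to the space of finite positive Borel measures on M equipped with the topology of weak convergence, let f : M × M → ℝ be continuous, and fix ε > 0. If the function x ↦ ∫ |f(x,y)|^{1+ε} dμ_x(y) is bounded above by a continuous function on M, then the function x ↦ ∫ f(x,y) dμ_x(y) is continuous on M. -/

import Mathlib

open MeasureTheory Filter Topology
open scoped ENNReal NNReal

noncomputable section

open BoundedContinuousFunction in
lemma aux_bdd {M : Type*} [MetricSpace M] [SecondCountableTopology M]
    [MeasurableSpace M] [BorelSpace M]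
    (μ : M → MeasureTheory.FiniteMeasure M) (hμ : Continuous μ) (F : (M × M) →ᵇ ℝ) :
    Continuous fun x => ∫ y, F (x, y) ∂(μ x).toMeasure := by
  rw [continuous_iff_continuousAt]
  intro x₀
  have : Nonempty M := ⟨x₀⟩
  have hmass : Tendsto (fun x => ((μ x).mass : ℝ)) (𝓝 x₀) (𝓝 ((μ x₀).mass : ℝ)) :=
    (NNReal.continuous_coe.tendsto _).comp (hμ.tendsto x₀).mass
  by_cases h0 : μ x₀ = 0
  · have hz : ∫ y, F (x₀, y) ∂(μ x₀).toMeasure = 0 := by simp [h0]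
    unfold ContinuousAt
    beta_reduce
    rw [hz]
    have h1 : Tendsto (fun x => ‖F‖ * ((μ x).mass : ℝ)) (𝓝 x₀) (𝓝 0) := by
      have := hmass.const_mul ‖F‖
      simpa [h0] using this
    refine squeeze_zero_norm (fun x => ?_) h1
    have := norm_integral_le_of_norm_le_const (μ := (μ x).toMeasure) (f := fun y => F (x, y))
      (C := ‖F‖) (Eventually.of_forall fun y => F.norm_coe_le_norm _)
    exact this
  · have key : ∀ x, ∫ y, F (x, y) ∂(μ x).toMeasure = ((μ x).mass : ℝ) *
        ∫ z, F z ∂((diracProba x).prod (μ x).normalize).toMeasure := by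
      intro x
      have h1 : ∫ z, F z ∂((diracProba x).prod (μ x).normalize).toMeasure
          = ∫ y, F (x, y) ∂(μ x).normalize.toMeasure := by
        rw [ProbabilityMeasure.toMeasure_prod]
        change ∫ z, F z ∂((Measure.dirac x).prod _) = _
        rw [Measure.dirac_prod, integral_map (by fun_prop)
          F.continuous.aestronglyMeasurable]
      rw [h1]
      conv_lhs => rw [(μ x).self_eq_mass_smul_normalize]
      rw [FiniteMeasure.toMeasure_smul, integral_smul_nnreal_measure]
      rfl
    simp_rw [key]
    refine ContinuousAt.mul hmass ?_
    have hn := FiniteMeasure.tendsto_normalize_of_tendsto (hμ.tendsto x₀) h0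
    have hp := (ProbabilityMeasure.continuous_prod.tendsto
      (diracProba x₀, (μ x₀).normalize)).comp
      ((continuous_diracProba.tendsto x₀).prodMk_nhds hn)
    exact ProbabilityMeasure.tendsto_iff_forall_integral_tendsto.1 hp F

lemma aux_clamp (a R ε : ℝ) (hR : 0 < R) (hε : 0 < ε) :
    |a - max (-R) (min R a)| ≤ |a| ^ (1 + ε) / R ^ ε := by
  have hRe : 0 < R ^ ε := Real.rpow_pos_of_pos hR _
  by_cases h : |a| ≤ R
  · obtain ⟨h1, h2⟩ := abs_le.1 h
    rw [min_eq_right h2, max_eq_right h1, sub_self, abs_zero]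
    positivity
  · push Not at h
    have ha : 0 < |a| := hR.trans h
    have h1 : |a - max (-R) (min R a)| ≤ |a| := by
      rcases lt_abs.1 h with h | h
      · rw [min_eq_left h.le, max_eq_right (by linarith), abs_of_pos (by linarith),
          abs_of_pos (by linarith)]
        linarith
      · rw [min_eq_right (by linarith), max_eq_left (by linarith), abs_of_neg (by linarith),
          abs_of_neg (by linarith)]
        linarith
    rw [le_div_iff₀ hRe, Real.rpow_add ha, Real.rpow_one]
    have := Real.rpow_le_rpow hR.le h.le hε.le
    gcongr

/-- **Lemma 8.6 ('generalized-DCT').** Let `M` be Polish, `x ↦ μ_x` a weakly continuous family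
of finite Borel measures, `f : M × M → ℝ` continuous, and `ε > 0`. If
`x ↦ ∫ |f(x,y)|^{1+ε} dμ_x(y)` is bounded above by a continuous function, then
`x ↦ ∫ f(x,y) dμ_x(y)` is continuous. -/
theorem generalized_DCT
    {M : Type*} [MetricSpace M] [CompleteSpace M] [SecondCountableTopology M]
    [MeasurableSpace M] [BorelSpace M]
    (μ : M → MeasureTheory.FiniteMeasure M) (hμ : Continuous μ)
    (f : M × M → ℝ) (hf : Continuous f) (ε : ℝ) (hε : 0 < ε)
    (g : M → ℝ) (hg : Continuous g)
    (hbound : ∀ x : M,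
      (∫⁻ y, ENNReal.ofReal (|f (x, y)| ^ (1 + ε)) ∂(μ x).toMeasure) ≤
        ENNReal.ofReal (g x)) :
    Continuous fun x => ∫ y, f (x, y) ∂(μ x).toMeasure := by
  rw [continuous_iff_continuousAt]
  intro x₀
  refine continuousAt_of_locally_uniform_approx_of_continuousAt fun u hu => ?_
  obtain ⟨δ, hδ, hδu⟩ := Metric.mem_uniformity_dist.1 hu
  set C : ℝ := max (g x₀) 0 + 1 with hC
  have hC0 : 0 < C := by positivity
  obtain ⟨R, hR, hR0⟩ : ∃ R : ℝ, C / δ < R ^ ε ∧ 0 < R :=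
    (((tendsto_rpow_atTop hε).eventually_gt_atTop (C / δ)).and (eventually_gt_atTop 0)).exists
  have hRe : 0 < R ^ ε := Real.rpow_pos_of_pos hR0 _
  have hFc : Continuous fun z => max (-R) (min R (f z)) := by fun_prop
  let F : BoundedContinuousFunction (M × M) ℝ :=
    BoundedContinuousFunction.ofNormedAddCommGroup (fun z => max (-R) (min R (f z))) hFc R
      (fun z => abs_le.2 ⟨le_max_left _ _, max_le (by linarith) (min_le_left _ _)⟩)
  have hgt : ∀ᶠ x in 𝓝 x₀, g x < C :=
    hg.continuousAt.eventually_lt continuousAt_const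
      (lt_of_le_of_lt (le_max_left (g x₀) 0) (by linarith))
  refine ⟨_, hgt, _, (aux_bdd μ hμ F).continuousAt, fun x hx => hδu ?_⟩
  have hx : g x < C := hx
  have hfx : Continuous fun y => f (x, y) := by fun_prop
  have hhc : Continuous fun y => |f (x, y)| ^ (1 + ε) :=
    hfx.abs.rpow_const fun _ => Or.inr (by linarith)
  have hh0 : ∀ y, 0 ≤ |f (x, y)| ^ (1 + ε) := fun y => by positivity
  have hhi : Integrable (fun y => |f (x, y)| ^ (1 + ε)) (μ x).toMeasure := by
    refine ⟨hhc.aestronglyMeasurable, ?_⟩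
    rw [hasFiniteIntegral_iff_ofReal (Eventually.of_forall hh0)]
    exact (hbound x).trans_lt ENNReal.ofReal_lt_top
  have hhC : ∫ y, |f (x, y)| ^ (1 + ε) ∂(μ x).toMeasure ≤ C := by
    rw [integral_eq_lintegral_of_nonneg_ae (Eventually.of_forall hh0) hhc.aestronglyMeasurable]
    exact ENNReal.toReal_le_of_le_ofReal hC0.le
      ((hbound x).trans (ENNReal.ofReal_le_ofReal hx.le))
  have hpt : ∀ y, ‖f (x, y) - F (x, y)‖ ≤ |f (x, y)| ^ (1 + ε) / R ^ ε :=
    fun y => aux_clamp _ R ε hR0 hε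
  have hFx : Continuous fun y => F (x, y) := by fun_prop
  have hFi : Integrable (fun y => F (x, y)) (μ x).toMeasure :=
    Integrable.of_bound hFx.aestronglyMeasurable ‖F‖
      (Eventually.of_forall fun y => F.norm_coe_le_norm _)
  have hdi : Integrable (fun y => f (x, y) - F (x, y)) (μ x).toMeasure :=
    (hhi.div_const (R ^ ε)).mono' (hfx.sub hFx).aestronglyMeasurable (Eventually.of_forall hpt)
  have hfi : Integrable (fun y => f (x, y)) (μ x).toMeasure := by
    refine (hdi.add hFi).congr (Eventually.of_forall fun y => ?_)
    simp
  rw [dist_eq_norm, ← integral_sub hfi hFi]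
  calc _ ≤ ∫ y, |f (x, y)| ^ (1 + ε) / R ^ ε ∂(μ x).toMeasure :=
        norm_integral_le_of_norm_le (hhi.div_const _) (Eventually.of_forall hpt)
    _ = (∫ y, |f (x, y)| ^ (1 + ε) ∂(μ x).toMeasure) / R ^ ε := integral_div _ _
    _ ≤ C / R ^ ε := by gcongr
    _ < δ := by
      rw [div_lt_iff₀ hδ] at hR
      rw [div_lt_iff₀ hRe]; linarith
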